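/- arXiv:2109.07005 — 8 statements merged into one kernel-verified Lean document; each statement's English description precedes it below -/
import Mathlib

section
/- Let 0 < c_s < 1 and 0 < c_p' ≤ 1, and let w', w : Fin m → ℝ be nonnegative weight vectors each summing to 1, with w' ≠ w. Define f(ν) := 1 − c_s · Σ_{i} max(w'_i − ν·w_i, 0) − c_p · Σ_{i} max(ν·w_i − w'_i, 0) and g(ν) := ν − f(ν). Then g is strictly increasing on the interval [0,1], g(0) < 0, and g(1) > 0. -/
/-- For 0 < c_s < 1 and 0 < c_p ≤ 1, and nonnegative weight vectors
w', w on `Fin m` each summing to 1 with w' ≠ w, the function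
g(ν) := ν − f(ν), with f(ν) := 1 − c_s Σᵢ (w'ᵢ − ν wᵢ)⁺ − c_p Σᵢ (ν wᵢ − w'ᵢ)⁺,
is strictly increasing on [0,1], with g(0) < 0 and g(1) > 0. -/
theorem stmt_0 (m : ℕ) (cs cp : ℝ)
    (hcs0 : 0 < cs) (hcs1 : cs < 1) (hcp0 : 0 < cp) (hcp1 : cp ≤ 1)
    (w' w : Fin m → ℝ)
    (hw'nn : ∀ i, 0 ≤ w' i) (hw'sum : ∑ i, w' i = 1)
    (hwnn : ∀ i, 0 ≤ w i) (hwsum : ∑ i, w i = 1)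
    (hne : w' ≠ w)
    (f g : ℝ → ℝ)
    (hf : ∀ ν, f ν = 1 - cs * ∑ i, max (w' i - ν * w i) 0
                      - cp * ∑ i, max (ν * w i - w' i) 0)
    (hg : ∀ ν, g ν = ν - f ν) :
    StrictMonoOn g (Set.Icc (0:ℝ) 1) ∧ g 0 < 0 ∧ 0 < g 1 := by
  have e : ∀ ν, g ν = ν - 1 + cs * ∑ i, max (w' i - ν * w i) 0
      + cp * ∑ i, max (ν * w i - w' i) 0 := by
    intro ν
    rw [hg, hf]
    ring
  refine ⟨?_, ?_, ?_⟩
  · intro a _ b _ hab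
    have h1 : ∑ i, max (w' i - a * w i) 0 ≤ ∑ i, max (w' i - b * w i) 0 + (b - a) := by
      have h : ∑ i, max (w' i - a * w i) 0
          ≤ ∑ i, (max (w' i - b * w i) 0 + (b - a) * w i) := by
        apply Finset.sum_le_sum
        intro i _
        have h0 : 0 ≤ (b - a) * w i := mul_nonneg (by linarith) (hwnn i)
        have h2 := le_max_left (w' i - b * w i) 0
        have h3 := le_max_right (w' i - b * w i) 0
        apply max_le <;> linarith
      rw [Finset.sum_add_distrib, ← Finset.mul_sum, hwsum, mul_one] at h
      exact h
    have h2 : ∑ i, max (a * w i - w' i) 0 ≤ ∑ i, max (b * w i - w' i) 0 := by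
      apply Finset.sum_le_sum
      intro i _
      have h0 : a * w i ≤ b * w i := mul_le_mul_of_nonneg_right hab.le (hwnn i)
      exact max_le_max (by linarith) le_rfl
    rw [e, e]
    have h3 := mul_le_mul_of_nonneg_left h1 hcs0.le
    have h4 := mul_le_mul_of_nonneg_left h2 hcp0.le
    have h5 : 0 < (1 - cs) * (b - a) := mul_pos (by linarith) (by linarith)
    linarith
  · have h1 : ∑ i, max (w' i - 0 * w i) 0 = 1 := by
      rw [← hw'sum]
      apply Finset.sum_congr rfl
      intro i _
      rw [zero_mul, sub_zero, max_eq_left (hw'nn i)]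
    have h2 : ∑ i, max (0 * w i - w' i) 0 = 0 := by
      apply Finset.sum_eq_zero
      intro i _
      exact max_eq_right (by linarith [hw'nn i])
    rw [e, h1, h2]
    linarith
  · obtain ⟨i, hi⟩ := Function.ne_iff.mp hne
    have hA : 0 ≤ ∑ i, max (w' i - 1 * w i) 0 :=
      Finset.sum_nonneg fun i _ => le_max_right _ _
    have hB : 0 ≤ ∑ i, max (1 * w i - w' i) 0 :=
      Finset.sum_nonneg fun i _ => le_max_right _ _
    have hA' := mul_nonneg hcs0.le hA
    have hB' := mul_nonneg hcp0.le hB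
    rw [e]
    rcases lt_or_gt_of_ne hi with h | h
    · have : 0 < ∑ i, max (1 * w i - w' i) 0 :=
        Finset.sum_pos' (fun i _ => le_max_right _ _)
          ⟨i, Finset.mem_univ i, lt_max_of_lt_left (by linarith)⟩
      have := mul_pos hcp0 this
      linarith
    · have : 0 < ∑ i, max (w' i - 1 * w i) 0 :=
        Finset.sum_pos' (fun i _ => le_max_right _ _)
          ⟨i, Finset.mem_univ i, lt_max_of_lt_left (by linarith)⟩
      have := mul_pos hcs0 this
      linarith
end

section
/- Let 0 < c_s < 1 and 0 < c_p < 1, and let w', w : Fin m → ℝ be nonnegative weight vectors each summing to 1. Define g(ν) := ν − 1 + c_s · Σ_{i} max(w'_i − ν·w_i, 0) + c_p · Σ_{i} max(ν·w_i − w'_i, 0). Then for all ν ≥ 0, g(ν) ≥ g(0) + ν · (1 − c_s + c_p · Σ_{i : w'_i = 0} w_i); that is, g is supported at 0 by a plane with strictly positive slope. -/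
/-- For 0 < c_s < 1 and 0 < c_p < 1, and nonnegative weight vectors
w', w on `Fin m` each summing to 1, the function
g(ν) := ν − 1 + c_s Σᵢ (w'ᵢ − ν wᵢ)⁺ + c_p Σᵢ (ν wᵢ − w'ᵢ)⁺ satisfies, for all ν ≥ 0,
g(ν) ≥ g(0) + ν (1 − c_s + c_p Σ_{i : w'ᵢ = 0} wᵢ); i.e., g is supported at 0 by a
plane with strictly positive slope. -/
theorem stmt_4 (m : ℕ) (cs cp : ℝ)
    (hcs0 : 0 < cs) (hcs1 : cs < 1) (hcp0 : 0 < cp) (hcp1 : cp < 1)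
    (w' w : Fin m → ℝ)
    (hw'nn : ∀ i, 0 ≤ w' i) (hw'sum : ∑ i, w' i = 1)
    (hwnn : ∀ i, 0 ≤ w i) (hwsum : ∑ i, w i = 1)
    (g : ℝ → ℝ)
    (hg : ∀ ν, g ν = ν - 1 + cs * ∑ i, max (w' i - ν * w i) 0
                           + cp * ∑ i, max (ν * w i - w' i) 0) :
    (∀ ν : ℝ, 0 ≤ ν →
      g ν ≥ g 0 + ν * (1 - cs + cp * ∑ i ∈ Finset.univ.filter (fun i => w' i = 0), w i)) ∧
    0 < 1 - cs + cp * ∑ i ∈ Finset.univ.filter (fun i => w' i = 0), w i := by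
  have hS : 0 ≤ ∑ i ∈ Finset.univ.filter (fun i => w' i = 0), w i :=
    Finset.sum_nonneg fun i _ => hwnn i
  refine ⟨fun ν hν => ?_, by nlinarith [mul_nonneg hcp0.le hS]⟩
  have h0 : g 0 = -1 + cs := by
    have e1 : ∑ i, max (w' i - 0 * w i) 0 = 1 := by
      rw [← hw'sum]
      refine Finset.sum_congr rfl fun i _ => ?_
      rw [zero_mul, sub_zero, max_eq_left (hw'nn i)]
    have e2 : ∑ i, max (0 * w i - w' i) 0 = 0 := by
      refine Finset.sum_eq_zero fun i _ => ?_
      rw [zero_mul, zero_sub]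
      exact max_eq_right (neg_nonpos.mpr (hw'nn i))
    rw [hg, e1, e2]
    ring
  have h1 : 1 - ν ≤ ∑ i, max (w' i - ν * w i) 0 := by
    calc 1 - ν = ∑ i, (w' i - ν * w i) := by
          rw [Finset.sum_sub_distrib, ← Finset.mul_sum, hw'sum, hwsum, mul_one]
      _ ≤ _ := Finset.sum_le_sum fun i _ => le_max_left _ _
  have h2 : ν * ∑ i ∈ Finset.univ.filter (fun i => w' i = 0), w i
      ≤ ∑ i, max (ν * w i - w' i) 0 := by
    rw [Finset.mul_sum, Finset.sum_filter]
    refine Finset.sum_le_sum fun i _ => ?_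
    split_ifs with h
    · rw [h, sub_zero]
      exact le_max_left _ _
    · exact le_max_right _ _
  rw [h0, hg]
  have a := mul_le_mul_of_nonneg_left h1 hcs0.le
  have b := mul_le_mul_of_nonneg_left h2 hcp0.le
  linarith
end

section
/- Let 0 < c_s < 1 and 0 < c_p < 1, and let w', w : Fin m → ℝ be nonnegative weight vectors each summing to 1. Define g(ν) := ν − 1 + c_s · Σ_{i} max(w'_i − ν·w_i, 0) + c_p · Σ_{i} max(ν·w_i − w'_i, 0). Then g is strictly increasing on [0, ∞). -/
/-- For 0 < c_s < 1 and 0 < c_p < 1, and nonnegative weight vectors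
w', w on `Fin m` each summing to 1, the function
g(ν) := ν − 1 + c_s Σᵢ (w'ᵢ − ν wᵢ)⁺ + c_p Σᵢ (ν wᵢ − w'ᵢ)⁺
is strictly increasing on [0, ∞). -/
theorem stmt_5 (m : ℕ) (cs cp : ℝ)
    (hcs0 : 0 < cs) (hcs1 : cs < 1) (hcp0 : 0 < cp) (hcp1 : cp < 1)
    (w' w : Fin m → ℝ)
    (hw'nn : ∀ i, 0 ≤ w' i) (hw'sum : ∑ i, w' i = 1)
    (hwnn : ∀ i, 0 ≤ w i) (hwsum : ∑ i, w i = 1)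
    (g : ℝ → ℝ)
    (hg : ∀ ν, g ν = ν - 1 + cs * ∑ i, max (w' i - ν * w i) 0
                           + cp * ∑ i, max (ν * w i - w' i) 0) :
    StrictMonoOn g (Set.Ici (0:ℝ)) := by
  intro a _ b _ hab
  have h1 : ∑ i, max (w' i - a * w i) 0 ≤ ∑ i, max (w' i - b * w i) 0 + (b - a) := by
    have h : ∑ i, max (w' i - a * w i) 0
        ≤ ∑ i, (max (w' i - b * w i) 0 + (b - a) * w i) := by
      apply Finset.sum_le_sum
      intro i _
      have hp : 0 ≤ (b - a) * w i := mul_nonneg (by linarith) (hwnn i)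
      have := le_max_left (w' i - b * w i) 0
      have := le_max_right (w' i - b * w i) 0
      apply max_le <;> linarith
    rwa [Finset.sum_add_distrib, ← Finset.mul_sum, hwsum, mul_one] at h
  have h2 : ∑ i, max (a * w i - w' i) 0 ≤ ∑ i, max (b * w i - w' i) 0 := by
    apply Finset.sum_le_sum
    intro i _
    have := mul_le_mul_of_nonneg_right hab.le (hwnn i)
    exact max_le_max (by linarith) le_rfl
  have h3 := mul_le_mul_of_nonneg_left h1 hcs0.le
  have h4 := mul_le_mul_of_nonneg_left h2 hcp0.le
  have h5 : cs * (b - a) < 1 * (b - a) := mul_lt_mul_of_pos_right hcs1 (by linarith)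
  rw [hg, hg]
  rw [mul_add] at h3
  linarith
end

section
/- Let 0 < c_s < 1 and 0 < c_p < 1, and let w', w : Fin m → ℝ be nonnegative weight vectors each summing to 1, with w' ≠ w. Define f(ν) := 1 − c_s · Σ_{i} max(w'_i − ν·w_i, 0) − c_p · Σ_{i} max(ν·w_i − w'_i, 0). Then there exists a unique ν ∈ (0, 1) such that ν = f(ν). -/
/-- For 0 < c_s < 1 and 0 < c_p < 1, and nonnegative weight vectors
w', w on `Fin m` each summing to 1 with w' ≠ w, the function
f(ν) := 1 − c_s Σᵢ (w'ᵢ − ν wᵢ)⁺ − c_p Σᵢ (ν wᵢ − w'ᵢ)⁺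
has a unique fixed point ν = f(ν) in the open interval (0, 1). -/
theorem stmt_6 (m : ℕ) (cs cp : ℝ)
    (hcs0 : 0 < cs) (hcs1 : cs < 1) (hcp0 : 0 < cp) (hcp1 : cp < 1)
    (w' w : Fin m → ℝ)
    (hw'nn : ∀ i, 0 ≤ w' i) (hw'sum : ∑ i, w' i = 1)
    (hwnn : ∀ i, 0 ≤ w i) (hwsum : ∑ i, w i = 1)
    (hne : w' ≠ w)
    (f : ℝ → ℝ)
    (hf : ∀ ν, f ν = 1 - cs * ∑ i, max (w' i - ν * w i) 0
                       - cp * ∑ i, max (ν * w i - w' i) 0) :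
    ∃! ν : ℝ, ν ∈ Set.Ioo (0:ℝ) 1 ∧ ν = f ν := by
  have hS : ∀ a b : ℝ, a ≤ b → ∑ i, max (w' i - a * w i) 0
      ≤ ∑ i, max (w' i - b * w i) 0 + (b - a) := by
    intro a b hab
    have h1 : (b - a) = ∑ i, (b - a) * w i := by rw [← Finset.mul_sum, hwsum, mul_one]
    rw [h1, ← Finset.sum_add_distrib]
    refine Finset.sum_le_sum fun i _ => ?_
    have h2 : 0 ≤ (b - a) * w i := mul_nonneg (by linarith) (hwnn i)
    refine max_le ?_ ?_
    · have := le_max_left (w' i - b * w i) 0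
      linarith
    · have := le_max_right (w' i - b * w i) 0
      linarith
  have hP : ∀ a b : ℝ, a ≤ b → ∑ i, max (a * w i - w' i) 0
      ≤ ∑ i, max (b * w i - w' i) 0 := by
    intro a b hab
    refine Finset.sum_le_sum fun i _ => ?_
    have h2 : a * w i ≤ b * w i := mul_le_mul_of_nonneg_right hab (hwnn i)
    exact max_le_max (by linarith) le_rfl
  have hmono : ∀ a b : ℝ, a < b → f b - f a < b - a := by
    intro a b hab
    have h1 := mul_le_mul_of_nonneg_left (hS a b hab.le) hcs0.le
    have h2 := mul_le_mul_of_nonneg_left (hP a b hab.le) hcp0.le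
    have h3 := mul_lt_mul_of_pos_right hcs1 (sub_pos.2 hab)
    rw [hf a, hf b]
    linarith
  have hcont : Continuous f := by
    rw [funext hf]
    fun_prop
  have h0 : 0 < f 0 := by
    have e1 : ∀ i, max (w' i - 0 * w i) 0 = w' i := fun i => by simp [hw'nn i]
    have e2 : ∀ i, max (0 * w i - w' i) 0 = 0 := fun i => by simp [hw'nn i]
    rw [hf]
    simp only [e1, e2, hw'sum, Finset.sum_const_zero]
    linarith
  have h1 : f 1 < 1 := by
    obtain ⟨j, hj⟩ := Function.ne_iff.1 hne
    have n1 : ∀ i ∈ Finset.univ, 0 ≤ max (w' i - 1 * w i) 0 := fun i _ => le_max_right _ _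
    have n2 : ∀ i ∈ Finset.univ, 0 ≤ max (1 * w i - w' i) 0 := fun i _ => le_max_right _ _
    have s1 := mul_nonneg hcs0.le (Finset.sum_nonneg n1)
    have s2 := mul_nonneg hcp0.le (Finset.sum_nonneg n2)
    rw [hf]
    rcases lt_or_gt_of_ne hj with h | h
    · have : 0 < ∑ i, max (1 * w i - w' i) 0 :=
        Finset.sum_pos' n2 ⟨j, Finset.mem_univ j, lt_max_of_lt_left (by linarith)⟩
      have := mul_pos hcp0 this
      linarith
    · have : 0 < ∑ i, max (w' i - 1 * w i) 0 :=
        Finset.sum_pos' n1 ⟨j, Finset.mem_univ j, lt_max_of_lt_left (by linarith)⟩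
      have := mul_pos hcs0 this
      linarith
  have hg : ContinuousOn (fun x => x - f x) (Set.Icc 0 1) := by fun_prop
  obtain ⟨x, hx, hx'⟩ := intermediate_value_Ioo (zero_le_one : (0:ℝ) ≤ 1) hg
    (show (0:ℝ) ∈ Set.Ioo (0 - f 0) (1 - f 1) from ⟨by linarith, by linarith⟩)
  have hxe : x = f x := sub_eq_zero.1 hx'
  refine ⟨x, ⟨hx, hxe⟩, ?_⟩
  rintro y ⟨-, hy⟩
  rcases lt_trichotomy y x with h | h | h
  · have := hmono y x h
    linarith
  · exact h
  · have := hmono x y h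
    linarith
end

section
/- For weights w : Fin (m+1) → Fin d → ℝ and bias b ∈ ℝ, define the Corr layer function B_{w,b} : (Fin m → Fin h → Fin d → ℝ) → (Fin m → Fin h → ℝ) by (B_{w,b} T) i t = Σ_k (w 0 k) · (T i t k) + Σ_{j ∈ Fin m} Σ_k (w (j+1) k) · (T j t k) + b. Then the Corr layer block 𝓑 := {B_{w,b} : w : Fin (m+1) → Fin d → ℝ, b ∈ ℝ} is asset permutation invariant. -/
/-- The asset permutation operator σ_π on tensors: (σ_π T) i = T (π i). -/
def assetPerm {m : ℕ} {α : Type*} (π : Equiv.Perm (Fin m)) (T : Fin m → α) :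
    Fin m → α :=
  fun i => T (π i)

/-- A block 𝓑 (a set of functions from input tensors of shape m×h×d, i.e.
`Fin m → α` with `α = Fin h → Fin d → ℝ`, to output tensors of shape m×h'×d')
is asset permutation invariant if for every permutation π of `Fin m`,
{σ_π⁻¹ ∘ B ∘ σ_π : B ∈ 𝓑} = 𝓑, where (σ_π⁻¹ O) i = O (π⁻¹ i). -/
def IsAssetPermInvariant {m : ℕ} {α β : Type*}
    (𝓑 : Set ((Fin m → α) → (Fin m → β))) : Prop :=
  ∀ π : Equiv.Perm (Fin m),
    (fun B : (Fin m → α) → (Fin m → β) =>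
      fun T => assetPerm π⁻¹ (B (assetPerm π T))) '' 𝓑 = 𝓑

/-- The Corr layer function of the WaveCorr architecture: for weights
w : Fin (m+1) → Fin d → ℝ and bias b,
(corrLayer w b T) i t = Σ_k w 0 k · T i t k + Σ_j Σ_k w (j+1) k · T j t k + b. -/
def corrLayer {m h d : ℕ} (w : Fin (m + 1) → Fin d → ℝ) (b : ℝ)
    (T : Fin m → Fin h → Fin d → ℝ) : Fin m → Fin h → ℝ :=
  fun i t => (∑ k, w 0 k * T i t k) + (∑ j, ∑ k, w j.succ k * T j t k) + b

theorem corr_conj {m h d : ℕ} (w : Fin (m + 1) → Fin d → ℝ) (b : ℝ)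
    (π : Equiv.Perm (Fin m)) :
    (fun T : Fin m → Fin h → Fin d → ℝ => assetPerm π⁻¹ (corrLayer w b (assetPerm π T))) =
      corrLayer (Fin.cons (w 0) (fun j => w (π⁻¹ j).succ)) b := by
  funext T i t
  have key : (∑ j, ∑ k, w j.succ k * T (π j) t k) =
      ∑ j, ∑ k, w (π⁻¹ j).succ k * T j t k := by
    rw [← Equiv.sum_comp π (fun j => ∑ k, w (π⁻¹ j).succ k * T j t k)]
    simp
  simp [assetPerm, corrLayer] at key ⊢
  exact key

/-- The Corr layer block {B_{w,b} : w, b} is asset permutation invariant. -/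
theorem stmt_12 (m h d : ℕ) :
    IsAssetPermInvariant
      {B : (Fin m → Fin h → Fin d → ℝ) → (Fin m → Fin h → ℝ) |
        ∃ (w : Fin (m + 1) → Fin d → ℝ) (b : ℝ), B = corrLayer w b} := by
  intro π
  ext B
  constructor
  · rintro ⟨_, ⟨w, b, rfl⟩, rfl⟩
    exact ⟨_, b, corr_conj w b π⟩
  · rintro ⟨w, b, rfl⟩
    refine ⟨_, ⟨Fin.cons (w 0) (fun j => w (π j).succ), b, rfl⟩, ?_⟩
    refine (corr_conj _ b π).trans ?_
    congr 1
    funext j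
    refine Fin.cases ?_ (fun j => ?_) j <;> simp
end

section
/- For weights w : Fin (m+1) → Fin d → ℝ and bias b ∈ ℝ, define B_{w,b} : (Fin m → Fin h → Fin d → ℝ) → (Fin m → Fin h → ℝ) by (B_{w,b} T) i t = Σ_k (w 0 k) · (T i t k) + Σ_{j ∈ Fin m} Σ_k (w (j+1) k) · (T j t k) + b. Let π be any permutation of Fin m. Define w' : Fin (m+1) → Fin d → ℝ by w' 0 = w 0 and w' (j+1) = w (π(j)+1) for j ∈ Fin m, and set b' = b. Then σ_π⁻¹ ∘ B_{w',b'} ∘ σ_π = B_{w,b}. -/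
/-- For any permutation π of `Fin m`, the reindexed weights
w' 0 = w 0, w' (j+1) = w (π j + 1) (and b' = b) satisfy
σ_π⁻¹ ∘ B_{w',b'} ∘ σ_π = B_{w,b}. -/
theorem stmt_13 (m h d : ℕ) (w : Fin (m + 1) → Fin d → ℝ) (b : ℝ)
    (π : Equiv.Perm (Fin m))
    (w' : Fin (m + 1) → Fin d → ℝ) (b' : ℝ)
    (hw'0 : w' 0 = w 0)
    (hw'succ : ∀ j : Fin m, w' j.succ = w (π j).succ)
    (hb' : b' = b) :
    (fun T => assetPerm π⁻¹ (corrLayer w' b' (assetPerm π T)))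
      = corrLayer (h := h) w b := by
  subst hb'
  funext T i t
  have hinv : π (π⁻¹ i) = i := π.apply_symm_apply i
  have hsum : (∑ j, ∑ k, w (π j).succ k * T (π j) t k)
      = ∑ j, ∑ k, w j.succ k * T j t k :=
    Equiv.sum_comp π (fun j => ∑ k, w j.succ k * T j t k)
  simp only [assetPerm, corrLayer, hw'0, hw'succ, hsum, hinv]
end

section
/- For w : Fin 5 → ℝ and b ∈ ℝ, define B_{w,b} : (Fin 5 → ℝ) → (Fin 5 → ℝ) by: (B_{w,b} T) 1 = w₃T₁ + w₄T₂ + w₅T₃ + b; (B_{w,b} T) 2 = w₂T₁ + w₃T₂ + w₄T₃ + w₅T₄ + b; (B_{w,b} T) 3 = w₁T₁ + w₂T₂ + w₃T₃ + w₄T₄ + w₅T₅ + b; (B_{w,b} T) 4 = w₁T₂ + w₂T₃ + w₃T₄ + w₄T₅ + b; (B_{w,b} T) 5 = w₁T₃ + w₂T₄ + w₃T₅ + b (indices written 1-based). Then the block 𝓑 := {B_{w,b} : w : Fin 5 → ℝ, b ∈ ℝ} is NOT asset permutation invariant: there exists a permutation π of Fin 5 such that {σ_π⁻¹ ∘ B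 ∘ σ_π : B ∈ 𝓑} ≠ 𝓑. -/
/-- The correlational convolution layer of Zhang et al. (2020) for m = 5, h = 1, d = 1:
a size-5 kernel w slid over the asset dimension with zero padding. Written 0-based
(so `w 0` is w₁ and `T 0` is T₁ of the 1-based description). -/
def zhangLayer (w : Fin 5 → ℝ) (b : ℝ) (T : Fin 5 → ℝ) : Fin 5 → ℝ :=
  ![w 2 * T 0 + w 3 * T 1 + w 4 * T 2 + b,
    w 1 * T 0 + w 2 * T 1 + w 3 * T 2 + w 4 * T 3 + b,
    w 0 * T 0 + w 1 * T 1 + w 2 * T 2 + w 3 * T 3 + w 4 * T 4 + b,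
    w 0 * T 1 + w 1 * T 2 + w 2 * T 3 + w 3 * T 4 + b,
    w 0 * T 2 + w 1 * T 3 + w 2 * T 4 + b]

/-- The block {B_{w,b} : w : Fin 5 → ℝ, b ∈ ℝ} of Zhang et al.'s
correlational convolution layer functions is NOT asset permutation invariant:
there is a permutation π of `Fin 5` with {σ_π⁻¹ ∘ B ∘ σ_π : B ∈ 𝓑} ≠ 𝓑. -/
theorem stmt_14 :
    ∃ π : Equiv.Perm (Fin 5),
      (fun B : (Fin 5 → ℝ) → (Fin 5 → ℝ) =>
          fun T => assetPerm π⁻¹ (B (assetPerm π T))) ''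
        {B | ∃ (w : Fin 5 → ℝ) (b : ℝ), B = zhangLayer w b}
      ≠ {B | ∃ (w : Fin 5 → ℝ) (b : ℝ), B = zhangLayer w b} := by
  refine ⟨Equiv.swap 0 1, fun h => ?_⟩
  have hmem := Set.ext_iff.mp h _ |>.mp
    (Set.mem_image_of_mem _ ⟨![0, 0, 0, 0, 1], 0, rfl⟩)
  obtain ⟨w, b, hB⟩ := hmem
  have e0 : (Equiv.swap (0 : Fin 5) 1) 0 = 1 := by decide
  have e3 : (Equiv.swap (0 : Fin 5) 1) 3 = 3 := by decide
  have e1 : (Equiv.swap (0 : Fin 5) 1) 1 = 0 := by decide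
  have e2 : (Equiv.swap (0 : Fin 5) 1) 2 = 2 := by decide
  have h1 := congrFun (congrFun hB ![0, 0, 0, 1, 0]) 0
  have h2 := congrFun (congrFun hB ![0, 0, 0, 0, 0]) 0
  simp [assetPerm, zhangLayer, e0, e1, e2, e3] at h1 h2
  linarith
end

section
/- With B_{w,b} : (Fin 5 → ℝ) → (Fin 5 → ℝ) the Zhang et al. correlational convolution layer functions (defined 1-based by (B_{w,b} T) i = Σ_{ℓ=1}^{5} w_ℓ · T_{i−3+ℓ} + b with zero padding T_{i'} = 0 for i' ∉ {1,...,5}), let π be the permutation of Fin 5 that swaps the first two assets and fixes the rest, and let w̄ : Fin 5 → ℝ satisfy w̄₄ ≠ w̄₁. Then there exist no w' : Fin 5 → ℝ and b' ∈ ℝ such that B_{w',b'} = σ_π⁻¹ ∘ B_{w̄,0} ∘ σ_π. -/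
/-- Let π be the permutation of `Fin 5` swapping the first two assets,
and let w̄ satisfy w̄₄ ≠ w̄₁ (0-based: w̄ 3 ≠ w̄ 0). Then no weights w' and bias b'
satisfy B_{w',b'} = σ_π⁻¹ ∘ B_{w̄,0} ∘ σ_π. -/
theorem stmt_15 (wbar : Fin 5 → ℝ) (hwbar : wbar 3 ≠ wbar 0) :
    ¬ ∃ (w' : Fin 5 → ℝ) (b' : ℝ),
        zhangLayer w' b' =
          fun T => assetPerm (Equiv.swap (0 : Fin 5) 1)⁻¹
            (zhangLayer wbar 0 (assetPerm (Equiv.swap (0 : Fin 5) 1) T)) := by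
  rintro ⟨w', b', h⟩
  have s0 : (Equiv.swap (0 : Fin 5) 1) 0 = 1 := by decide
  have s1 : (Equiv.swap (0 : Fin 5) 1) 1 = 0 := by decide
  have s2 : (Equiv.swap (0 : Fin 5) 1) 2 = 2 := by decide
  have s3 : (Equiv.swap (0 : Fin 5) 1) 3 = 3 := by decide
  have s4 : (Equiv.swap (0 : Fin 5) 1) 4 = 4 := by decide
  have h0 := congrFun (congrFun h ![0, 0, 0, 0, 0]) 0
  have h1 := congrFun (congrFun h ![1, 0, 0, 0, 0]) 1
  have h2 := congrFun (congrFun h ![0, 1, 0, 0, 0]) 2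
  simp [zhangLayer, assetPerm, s0, s1, s2, s3, s4] at h0 h1 h2
  apply hwbar
  linarith
end
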